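/- Let n be a positive integer, p ∈ (0,1), and let X_1,...,X_n be i.i.d. Bernoulli(p) with minimum X_(1) and maximum X_(n). Then the mutual information between X_(1) and X_(n) equals −(1−p)^n·log(1−p^n) − p^n·log(1−(1−p)^n) + (1 − p^n − (1−p)^n)·log((1 − p^n − (1−p)^n) / ((1−p^n)·(1−(1−p)^n))). In particular, this mutual information depends on the sampling parameter p. -/

import Mathlib

open MeasureTheory Real Filter Topology Classical

noncomputable section

/-- Kullback–Leibler divergence: `∫ log (dP/dQ) dP` when `P ≪ Q`, and `+∞` otherwise. -/
def klDiv {α : Type*} [MeasurableSpace α] (P Q : Measure α) : EReal :=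
  if P ≪ Q then ((∫ x, Real.log ((P.rnDeriv Q x).toReal) ∂P : ℝ) : EReal) else ⊤

/-- The nondecreasing rearrangement of a tuple: `sortTuple x i` is the `i`-th order
statistic (0-indexed) of the vector `x`. -/
def sortTuple {n : ℕ} (x : Fin n → ℝ) : Fin n → ℝ := x ∘ Tuple.sort x

/-- Law of an i.i.d. sample of size `n` from `μ`. -/
def sampleLaw (n : ℕ) (μ : Measure ℝ) : Measure (Fin n → ℝ) := Measure.pi fun _ => μ

/-- Law of the `i`-th order statistic (0-indexed) of an i.i.d. sample of size `n` from `μ`. -/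
def osLaw (n : ℕ) (μ : Measure ℝ) (i : Fin n) : Measure ℝ :=
  (sampleLaw n μ).map fun x => sortTuple x i

/-- Joint law of the order statistics indexed by `I`. -/
def orderLaw (n : ℕ) (μ : Measure ℝ) (I : Finset (Fin n)) : Measure (I → ℝ) :=
  (sampleLaw n μ).map fun x (i : I) => sortTuple x i.1

/-- Product of the marginal laws of the order statistics indexed by `I`. -/
def orderProdLaw (n : ℕ) (μ : Measure ℝ) (I : Finset (Fin n)) : Measure (I → ℝ) :=
  Measure.pi fun i : I => osLaw n μ i.1

/-- Mutual information between two tuples of order statistics. -/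
def miTuples (n : ℕ) (μ : Measure ℝ) (I₁ I₂ : Finset (Fin n)) : EReal :=
  klDiv
    ((sampleLaw n μ).map fun x =>
      ((fun i : I₁ => sortTuple x i.1), (fun i : I₂ => sortTuple x i.1)))
    ((orderLaw n μ I₁).prod (orderLaw n μ I₂))

/-- Mutual information between two single order statistics (0-indexed). -/
def miPair (n : ℕ) (μ : Measure ℝ) (r m : Fin n) : EReal :=
  klDiv ((sampleLaw n μ).map fun x => (sortTuple x r, sortTuple x m))
    ((osLaw n μ r).prod (osLaw n μ m))

/-- The uniform probability measure on `(0,1)`. -/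
def unif : Measure ℝ := volume.restrict (Set.Ioo 0 1)

/-- `T r = log (r!) - r * H_r`. -/
def T (r : ℕ) : ℝ := Real.log (Nat.factorial r) - r * (harmonic r : ℝ)

/-- The Bernoulli(p) law on `ℝ`, taking value `1` with probability `p` and `0` with
probability `1 - p`. -/
def bernoulliReal (p : ℝ) : Measure ℝ :=
  (ENNReal.ofReal p) • Measure.dirac 1 + (ENNReal.ofReal (1 - p)) • Measure.dirac 0

theorem osb_min_le {n : ℕ} (hn : 0 < n) (x : Fin n → ℝ) (i : Fin n) :
    sortTuple x ⟨0, hn⟩ ≤ x i := by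
  have h := Tuple.monotone_sort x (a := ⟨0, hn⟩) (b := (Tuple.sort x).symm i)
    (Fin.mk_le_of_le_val (Nat.zero_le _))
  simpa [sortTuple] using h

theorem osb_le_max {n : ℕ} (hn : n - 1 < n) (x : Fin n → ℝ) (i : Fin n) :
    x i ≤ sortTuple x ⟨n - 1, hn⟩ := by
  have h := Tuple.monotone_sort x (a := (Tuple.sort x).symm i) (b := ⟨n - 1, hn⟩)
    (by rw [Fin.le_def]; have := ((Tuple.sort x).symm i).2; simp only; omega)
  simpa [sortTuple] using h

theorem osb_meas_min {n : ℕ} (hn : 0 < n) :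
    Measurable fun x : Fin n → ℝ => sortTuple x ⟨0, hn⟩ := by
  apply measurable_of_Ici
  intro c
  have : (fun x : Fin n → ℝ => sortTuple x ⟨0, hn⟩) ⁻¹' Set.Ici c
      = ⋂ i, {x : Fin n → ℝ | c ≤ x i} := by
    ext x
    simp only [Set.mem_preimage, Set.mem_Ici, Set.mem_iInter, Set.mem_setOf_eq]
    exact ⟨fun h i => h.trans (osb_min_le hn x i), fun h => h _⟩
  rw [this]
  exact MeasurableSet.iInter fun i => measurableSet_le measurable_const (measurable_pi_apply i)

theorem osb_meas_max {n : ℕ} (hn : n - 1 < n) :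
    Measurable fun x : Fin n → ℝ => sortTuple x ⟨n - 1, hn⟩ := by
  apply measurable_of_Iic
  intro c
  have : (fun x : Fin n → ℝ => sortTuple x ⟨n - 1, hn⟩) ⁻¹' Set.Iic c
      = ⋂ i, {x : Fin n → ℝ | x i ≤ c} := by
    ext x
    simp only [Set.mem_preimage, Set.mem_Iic, Set.mem_iInter, Set.mem_setOf_eq]
    exact ⟨fun h i => (osb_le_max hn x i).trans h, fun h => h _⟩
  rw [this]
  exact MeasurableSet.iInter fun i => measurableSet_le (measurable_pi_apply i) measurable_const

theorem osb_three {α : Type*} [MeasurableSpace α] [MeasurableSingletonClass α]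
    (μ : Measure α) [IsProbabilityMeasure μ] (a b c : α) (hab : a ≠ b) (hac : a ≠ c)
    (hbc : b ≠ c) (h : ∀ᵐ z ∂μ, z = a ∨ z = b ∨ z = c) (u v : ℝ) (hu : 0 ≤ u) (hv : 0 ≤ v)
    (ha : μ {a} = ENNReal.ofReal u) (hb : μ {b} = ENNReal.ofReal v) :
    μ = ENNReal.ofReal u • Measure.dirac a + (ENNReal.ofReal v • Measure.dirac b
      + ENNReal.ofReal (1 - u - v) • Measure.dirac c) := by
  have key : μ = μ {a} • Measure.dirac a + (μ {b} • Measure.dirac b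
      + μ {c} • Measure.dirac c) := by
    have h1 : μ.restrict ({a} ∪ ({b} ∪ {c})) = μ := by
      apply Measure.restrict_eq_self_of_ae_mem
      filter_upwards [h] with z hz
      simp only [Set.mem_union, Set.mem_singleton_iff]
      exact hz
    conv_lhs => rw [← h1]
    rw [Measure.restrict_union (by simp [hab, hac])
      ((measurableSet_singleton b).union (measurableSet_singleton c)),
      Measure.restrict_union (by simp [hbc]) (measurableSet_singleton c)]
    simp only [Measure.restrict_singleton]
  have hc : μ {c} = ENNReal.ofReal (1 - u - v) := by
    have h2 : μ Set.univ = μ {a} + (μ {b} + μ {c}) := by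
      conv_lhs => rw [key]
      simp
    have h3 := congrArg ENNReal.toReal h2
    rw [measure_univ, ENNReal.toReal_add (measure_ne_top _ _) (by simp),
      ENNReal.toReal_add (measure_ne_top _ _) (measure_ne_top _ _), ha, hb,
      ENNReal.toReal_ofReal hu, ENNReal.toReal_ofReal hv, ENNReal.toReal_one] at h3
    rw [← ENNReal.ofReal_toReal (measure_ne_top μ {c})]
    congr 1
    linarith
  rw [← ha, ← hb, ← hc]
  exact key

theorem osb_prob {p : ℝ} (hp : p ∈ Set.Ioo (0 : ℝ) 1) :
    IsProbabilityMeasure (bernoulliReal p) := by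
  constructor
  simp only [bernoulliReal, Measure.add_apply, Measure.smul_apply, measure_univ, smul_eq_mul,
    mul_one]
  rw [← ENNReal.ofReal_add hp.1.le (by linarith [hp.2])]
  simp

theorem osb_joint (n : ℕ) (hn : 0 < n) (hn' : n - 1 < n) (p : ℝ) (hp : p ∈ Set.Ioo (0 : ℝ) 1) :
    (sampleLaw n (bernoulliReal p)).map
      (fun x => (sortTuple x ⟨0, hn⟩, sortTuple x ⟨n - 1, hn'⟩))
    = ENNReal.ofReal (p ^ n) • Measure.dirac ((1 : ℝ), (1 : ℝ))
      + (ENNReal.ofReal ((1 - p) ^ n) • Measure.dirac ((0 : ℝ), (0 : ℝ))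
      + ENNReal.ofReal (1 - p ^ n - (1 - p) ^ n) • Measure.dirac ((0 : ℝ), (1 : ℝ))) := by
  have := osb_prob hp
  have : IsProbabilityMeasure (sampleLaw n (bernoulliReal p)) := by
    unfold sampleLaw; infer_instance
  have hm : Measurable (fun x : Fin n → ℝ => (sortTuple x ⟨0, hn⟩, sortTuple x ⟨n - 1, hn'⟩)) :=
    (osb_meas_min hn).prodMk (osb_meas_max hn')
  have := Measure.isProbabilityMeasure_map (μ := sampleLaw n (bernoulliReal p)) hm.aemeasurable
  have hq : 0 < 1 - p := by linarith [hp.2]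
  have hpre : ∀ c : ℝ, (fun x : Fin n → ℝ => (sortTuple x ⟨0, hn⟩, sortTuple x ⟨n - 1, hn'⟩)) ⁻¹'
      {(c, c)} = {fun _ => c} := by
    intro c
    ext x
    simp only [Set.mem_preimage, Set.mem_singleton_iff, Prod.mk.injEq]
    constructor
    · rintro ⟨h1, h2⟩
      funext i
      exact le_antisymm (h2 ▸ osb_le_max hn' x i) (h1 ▸ osb_min_le hn x i)
    · rintro rfl
      exact ⟨rfl, rfl⟩
  apply osb_three
  · simp
  · simp
  · simp
  · have hall : ∀ᵐ x ∂(sampleLaw n (bernoulliReal p)), ∀ i, x i = 0 ∨ x i = 1 := by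
      rw [ae_all_iff]
      intro i
      have h0 : ∀ᵐ y ∂(bernoulliReal p), y = 0 ∨ y = 1 := by
        have hs : MeasurableSet {y : ℝ | y = 0 ∨ y = 1} :=
          (measurableSet_singleton (0:ℝ)).union (measurableSet_singleton 1)
        rw [ae_iff, ← Set.compl_setOf]
        simp [bernoulliReal, Measure.dirac_apply' _ hs.compl]
      exact (measurePreserving_eval (fun _ : Fin n => bernoulliReal p) i).quasiMeasurePreserving.ae h0
    have hs : MeasurableSet {z : ℝ × ℝ | z = (1, 1) ∨ z = (0, 0) ∨ z = (0, 1)} :=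
      (measurableSet_singleton _).union
        ((measurableSet_singleton _).union (measurableSet_singleton _))
    rw [ae_map_iff hm.aemeasurable hs]
    filter_upwards [hall] with x hx
    have h1 : sortTuple x ⟨0, hn⟩ = 0 ∨ sortTuple x ⟨0, hn⟩ = 1 := hx _
    have h2 : sortTuple x ⟨n - 1, hn'⟩ = 0 ∨ sortTuple x ⟨n - 1, hn'⟩ = 1 := hx _
    have h3 : sortTuple x ⟨0, hn⟩ ≤ sortTuple x ⟨n - 1, hn'⟩ :=
      (osb_min_le hn x ⟨0, hn⟩).trans (osb_le_max hn' x _)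
    rcases h1 with h1 | h1 <;> rcases h2 with h2 | h2 <;> rw [h1, h2] at h3 ⊢ <;> simp
    linarith
  · have := hp.1; positivity
  · positivity
  · rw [Measure.map_apply hm (measurableSet_singleton _), hpre, sampleLaw, Measure.pi_singleton]
    simp [bernoulliReal, ENNReal.ofReal_pow hp.1.le]
  · rw [Measure.map_apply hm (measurableSet_singleton _), hpre, sampleLaw, Measure.pi_singleton]
    simp [bernoulliReal, ENNReal.ofReal_pow hq.le]

theorem osb_withDensity_dirac {α : Type*} [MeasurableSpace α] [MeasurableSingletonClass α]
    (a : α) (f : α → ENNReal) : (Measure.dirac a).withDensity f = f a • Measure.dirac a := by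
  ext s hs
  rw [withDensity_apply _ hs]
  by_cases h : a ∈ s <;> simp [hs, h, restrict_dirac]

theorem osb_kl (u v : ℝ) (hu : 0 < u) (hv : 0 < v) (hu1 : u < 1) (hv1 : v < 1)
    (huv : u + v ≤ 1) (P Q : Measure (ℝ × ℝ))
    (hP : P = ENNReal.ofReal u • Measure.dirac ((1 : ℝ), (1 : ℝ))
      + (ENNReal.ofReal v • Measure.dirac ((0 : ℝ), (0 : ℝ))
      + ENNReal.ofReal (1 - u - v) • Measure.dirac ((0 : ℝ), (1 : ℝ))))
    (hQ : Q = (P.map Prod.fst).prod (P.map Prod.snd)) :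
    klDiv P Q = ((-v * Real.log (1 - u) - u * Real.log (1 - v)
          + (1 - u - v) * Real.log ((1 - u - v) / ((1 - u) * (1 - v))) : ℝ) : EReal) := by
  have h1 : P.map Prod.fst = ENNReal.ofReal u • Measure.dirac (1 : ℝ)
      + ENNReal.ofReal (1 - u) • Measure.dirac (0 : ℝ) := by
    rw [hP, Measure.map_add _ _ measurable_fst, Measure.map_add _ _ measurable_fst]
    simp only [Measure.map_smul, Measure.map_dirac' measurable_fst]
    rw [← add_smul, ← ENNReal.ofReal_add hv.le (by linarith)]
    congr 3; ring_nf
  have h2 : P.map Prod.snd = ENNReal.ofReal v • Measure.dirac (0 : ℝ)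
      + ENNReal.ofReal (1 - v) • Measure.dirac (1 : ℝ) := by
    rw [hP, Measure.map_add _ _ measurable_snd, Measure.map_add _ _ measurable_snd]
    simp only [Measure.map_smul, Measure.map_dirac' measurable_snd]
    rw [add_left_comm, ← add_smul, ← ENNReal.ofReal_add hu.le (by linarith)]
    congr 3; ring_nf
  have hQ' : Q = (ENNReal.ofReal (u * v) • Measure.dirac ((1 : ℝ), (0 : ℝ))
      + ENNReal.ofReal (u * (1 - v)) • Measure.dirac ((1 : ℝ), (1 : ℝ)))
      + (ENNReal.ofReal ((1 - u) * v) • Measure.dirac ((0 : ℝ), (0 : ℝ))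
      + ENNReal.ofReal ((1 - u) * (1 - v)) • Measure.dirac ((0 : ℝ), (1 : ℝ))) := by
    rw [hQ, h1, h2, ENNReal.ofReal_mul hu.le, ENNReal.ofReal_mul hu.le,
      ENNReal.ofReal_mul (by linarith), ENNReal.ofReal_mul (by linarith)]
    simp only [Measure.prod_add, Measure.add_prod, Measure.prod_smul_left,
      Measure.prod_smul_right, Measure.dirac_prod_dirac, smul_add, smul_smul]
    simp only [mul_comm]
    abel
  let f : ℝ × ℝ → ℝ := fun z =>
    if z = (1, 1) then 1 / (1 - v) else if z = (0, 0) then 1 / (1 - u) else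
      if z = (0, 1) then (1 - u - v) / ((1 - u) * (1 - v)) else 0
  have f1 : f (1, 1) = 1 / (1 - v) := by simp [f]
  have f2 : f (0, 0) = 1 / (1 - u) := by simp [f]
  have f3 : f (0, 1) = (1 - u - v) / ((1 - u) * (1 - v)) := by simp [f]
  have f4 : f (1, 0) = 0 := by simp [f]
  have hu' : 0 < 1 - u := by linarith
  have hv' : 0 < 1 - v := by linarith
  have hw : 0 ≤ 1 - u - v := by linarith
  have f0 : ∀ z, 0 ≤ f z := by
    intro z
    simp only [f]
    split_ifs <;> positivity
  have hf : Measurable f := by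
    refine Measurable.ite (measurableSet_singleton _) measurable_const
      (Measurable.ite (measurableSet_singleton _) measurable_const
      (Measurable.ite (measurableSet_singleton _) measurable_const measurable_const))
  have hd : P = Q.withDensity (fun z => ENNReal.ofReal (f z)) := by
    rw [hP, hQ']
    simp only [withDensity_add_measure, withDensity_smul_measure, osb_withDensity_dirac, f1, f2,
      f3, f4, smul_smul]
    rw [← ENNReal.ofReal_mul (by positivity), ← ENNReal.ofReal_mul (by positivity),
      ← ENNReal.ofReal_mul (by positivity), ← ENNReal.ofReal_mul (by positivity)]
    have e1 : u * (1 - v) * (1 / (1 - v)) = u := by field_simp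
    have e2 : (1 - u) * v * (1 / (1 - u)) = v := by field_simp
    have e3 : (1 - u) * (1 - v) * ((1 - u - v) / ((1 - u) * (1 - v))) = 1 - u - v := by
      field_simp
    rw [e1, e2, e3]
    simp
  have : IsFiniteMeasure P := by
    constructor
    rw [hP]
    simp [ENNReal.add_lt_top]
  have : IsFiniteMeasure Q := by rw [hQ]; infer_instance
  have hac : P ≪ Q := by
    rw [hd]; exact withDensity_absolutelyContinuous _ _
  have hrn : P.rnDeriv Q =ᵐ[P] fun z => ENNReal.ofReal (f z) := by
    apply hac.ae_le
    have := Measure.rnDeriv_withDensity Q hf.ennreal_ofReal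
    rwa [← hd] at this
  rw [klDiv, if_pos hac]
  congr 1
  have hi : ∫ x, Real.log ((P.rnDeriv Q x).toReal) ∂P = ∫ x, Real.log (f x) ∂P := by
    apply integral_congr_ae
    filter_upwards [hrn] with z hz
    rw [hz, ENNReal.toReal_ofReal (f0 z)]
  have hint : ∀ (c : ℝ) (a : ℝ × ℝ), Integrable (fun x => Real.log (f x))
      (ENNReal.ofReal c • Measure.dirac a) := fun c a =>
    (integrable_dirac (by simp)).smul_measure ENNReal.ofReal_ne_top
  rw [hi, hP, integral_add_measure (hint _ _) ((hint _ _).add_measure (hint _ _)),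
    integral_add_measure (hint _ _) (hint _ _)]
  simp only [integral_smul_measure, integral_dirac, f1, f2, f3, one_div, Real.log_inv,
    ENNReal.toReal_ofReal hu.le, ENNReal.toReal_ofReal hv.le, ENNReal.toReal_ofReal hw,
    smul_eq_mul]
  ring

theorem osb_pow_add_le {n : ℕ} (hn : 0 < n) {p : ℝ} (hp : p ∈ Set.Ioo (0 : ℝ) 1) :
    p ^ n + (1 - p) ^ n ≤ 1 := by
  have h1 := pow_le_of_le_one hp.1.le hp.2.le hn.ne'
  have h2 := pow_le_of_le_one (a := 1 - p) (by linarith [hp.2]) (by linarith [hp.1]) hn.ne'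
  linarith

/-- Mutual information between the minimum and maximum of an i.i.d. Bernoulli(p)
sample; note that it depends on the sampling parameter `p`. -/
theorem mutualInfo_bernoulli_min_max
    (n : ℕ) (hn : 0 < n) (p : ℝ) (hp : p ∈ Set.Ioo (0 : ℝ) 1) :
    miPair n (bernoulliReal p) ⟨0, hn⟩ ⟨n - 1, by omega⟩
      = ((-(1 - p) ^ n * Real.log (1 - p ^ n) - p ^ n * Real.log (1 - (1 - p) ^ n)
          + (1 - p ^ n - (1 - p) ^ n) *
              Real.log ((1 - p ^ n - (1 - p) ^ n)
                / ((1 - p ^ n) * (1 - (1 - p) ^ n))) : ℝ) : EReal) := by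
  have hq : 0 < 1 - p := by linarith [hp.2]
  have hp0 : 0 < p := hp.1
  have hj := osb_joint n hn (by omega) p hp
  have hm1 := osb_meas_min hn
  have hm2 := osb_meas_max (n := n) (by omega)
  unfold miPair
  refine osb_kl (p ^ n) ((1 - p) ^ n) (by positivity) (by positivity)
    (pow_lt_one₀ hp0.le hp.2 hn.ne') (pow_lt_one₀ hq.le (by linarith) hn.ne')
    (osb_pow_add_le hn hp) _ _ hj ?_
  rw [Measure.map_map measurable_fst (hm1.prodMk hm2),
    Measure.map_map measurable_snd (hm1.prodMk hm2)]
  rfl
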